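/- Let 𝒞 be a well behaved causal set and Φ an automorphism of 𝒞 such that for every x ∈ 𝒞, x and Φ(x) are incomparable, and suppose x₀ ∈ 𝒞 and k₀ is an integer with k₀ ≥ 2 such that x₀ < Φ^{k₀}(x₀). Let Σ be the set of minimal elements of the set S = {x ∈ 𝒞 : x₀ < x and x ≠ Φ^ℓ(x₀) for every integer ℓ > 0}. Then Σ is nonempty. -/

import Mathlib

/-- `Φ` is an automorphism of the ordered set `C`. -/
def IsCausalAuto {C : Type} [PartialOrder C] (Φ : Equiv.Perm C) : Prop :=
  ∀ x y : C, x ≤ y ↔ Φ x ≤ Φ y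

/-- A countably infinite, locally finite poset `C` is a *well behaved causal set* if:
(a) every antichain is contained in the union of the pasts and futures of the points
of any maximal chain; (b) for every point `x` and every antichain `A`, both
`Past(x) ∩ A` and `Future(x) ∩ A` are finite; (c) `C` contains an infinite
antichain. -/
def IsWellBehavedCausalSet (C : Type) [PartialOrder C] : Prop :=
  (Countable C ∧ Infinite C) ∧
  (∀ x y : C, (Set.Icc x y).Finite) ∧
  (∀ Ch : Set C, IsMaxChain (· ≤ ·) Ch → ∀ A : Set C, IsAntichain (· ≤ ·) A →
    A ⊆ ⋃ x ∈ Ch, ({y : C | y ≤ x} ∪ {y : C | x ≤ y})) ∧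
  (∀ x : C, ∀ A : Set C, IsAntichain (· ≤ ·) A →
    ({y : C | y ≤ x} ∩ A).Finite ∧ ({y : C | x ≤ y} ∩ A).Finite) ∧
  (∃ A : Set C, IsAntichain (· ≤ ·) A ∧ A.Infinite)

/-- A temporal foliation of a poset `C`, given as a family of slices `X : I → Set C`
indexed by a linearly ordered type `I`. -/
def IsTemporalFoliation {C : Type} [PartialOrder C] {I : Type} [LinearOrder I]
    (X : I → Set C) : Prop :=
  (∀ i, (X i).Nonempty) ∧
  (∀ i j : I, i ≠ j → Disjoint (X i) (X j)) ∧
  (⋃ i, X i) = Set.univ ∧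
  (∀ i, IsAntichain (· ≤ ·) (X i)) ∧
  (∀ i j : I, i < j →
    (∃ x ∈ X i, ∃ y ∈ X j, x < y) ∧ (∀ z ∈ X i, ∀ t ∈ X j, ¬ t ≤ z))

theorem exists_not_le_of_strictMono {C : Type} [PartialOrder C]
    (hlf : ∀ x y : C, (Set.Icc x y).Finite) {f : ℕ → C} (hf : StrictMono f) (c : C) :
    ∃ n, ¬ f n ≤ c := by
  by_contra! h
  refine Set.infinite_range_of_injective hf.injective ((hlf (f 0) c).subset ?_)
  rintro _ ⟨n, rfl⟩
  exact ⟨hf.monotone n.zero_le, h n⟩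

theorem exists_not_ge_of_strictAnti {C : Type} [PartialOrder C]
    (hlf : ∀ x y : C, (Set.Icc x y).Finite) {f : ℕ → C} (hf : StrictAnti f) (c : C) :
    ∃ n, ¬ c ≤ f n := by
  by_contra! h
  refine Set.infinite_range_of_injective hf.injective ((hlf c (f 0)).subset ?_)
  rintro _ ⟨n, rfl⟩
  exact ⟨h n, hf.antitone n.zero_le⟩

/-- In a locally finite poset whose antichains meet pasts finitely, every infinite set
bounded above contains a strictly decreasing sequence. -/
theorem exists_strictAnti_of_infinite {C : Type} [PartialOrder C]
    (hlf : ∀ x y : C, (Set.Icc x y).Finite)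
    (hac : ∀ x : C, ∀ A : Set C, IsAntichain (· ≤ ·) A → ({y : C | y ≤ x} ∩ A).Finite)
    {P : Set C} {x : C} (hPx : ∀ y ∈ P, y ≤ x) (hP : P.Infinite) :
    ∃ d : ℕ → C, StrictAnti d ∧ ∀ n, d n ∈ P := by
  let f : ℕ → C := fun n => hP.natEmbedding P n
  have hfinj : Function.Injective f :=
    Subtype.val_injective.comp (hP.natEmbedding P).injective
  have hfP : ∀ n, f n ∈ P := fun n => (hP.natEmbedding P n).2
  obtain ⟨g, hg⟩ := exists_increasing_or_nonincreasing_subseq (· < ·) f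
  rcases hg with hg | hg
  · obtain ⟨n, hn⟩ := exists_not_le_of_strictMono hlf (f := f ∘ g)
      (fun a b hab => hg a b hab) x
    exact absurd (hPx _ (hfP _)) hn
  obtain ⟨g', hg'⟩ := exists_increasing_or_nonincreasing_subseq (· > ·) (f ∘ g)
  rcases hg' with hg' | hg'
  · exact ⟨(f ∘ g) ∘ g', fun a b hab => hg' a b hab, fun n => hfP _⟩
  exfalso
  have hinj : Function.Injective ((f ∘ g) ∘ g') :=
    (hfinj.comp g.injective).comp g'.injective
  have hanti : IsAntichain (· ≤ ·) (Set.range ((f ∘ g) ∘ g')) := by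
    rintro _ ⟨a, rfl⟩ _ ⟨b, rfl⟩ hne hle
    have hlt := lt_of_le_of_ne hle hne
    rcases lt_trichotomy a b with h | h | h
    · exact hg (g' a) (g' b) (g'.strictMono h) hlt
    · exact hne (by rw [h])
    · exact hg' b a h hlt
  refine Set.infinite_range_of_injective hinj ((hac x _ hanti).subset ?_)
  rintro _ ⟨a, rfl⟩
  exact ⟨hPx _ (hfP _), ⟨a, rfl⟩⟩

theorem IsCausalAuto.zpow_le_iff {C : Type} [PartialOrder C] {Φ : Equiv.Perm C}
    (hΦ : IsCausalAuto Φ) (n : ℤ) (x y : C) : (Φ ^ n) x ≤ (Φ ^ n) y ↔ x ≤ y := by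
  induction n with
  | zero => simp
  | succ n ih =>
    rw [add_comm, zpow_add, zpow_one, Equiv.Perm.mul_apply, Equiv.Perm.mul_apply, ← hΦ, ih]
  | pred n ih =>
    rw [hΦ, ← Equiv.Perm.mul_apply, ← Equiv.Perm.mul_apply, ← zpow_one_add]
    simpa using ih

theorem IsCausalAuto.strictMono_zpow_mul {C : Type} [PartialOrder C] {Φ : Equiv.Perm C}
    (hΦ : IsCausalAuto Φ) {k : ℤ} {y : C} (hy : y < (Φ ^ k) y) :
    StrictMono fun n : ℤ => (Φ ^ (k * n)) y := by
  refine strictMono_int_of_lt_succ fun n => ?_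
  have h : (Φ ^ (k * (n + 1))) y = (Φ ^ (k * n)) ((Φ ^ k) y) := by
    rw [← Equiv.Perm.mul_apply, ← zpow_add, mul_add, mul_one]
  rw [h]
  exact lt_of_le_of_ne ((hΦ.zpow_le_iff _ _ _).2 hy.le)
    fun he => hy.ne ((Φ ^ (k * n)).injective he)

theorem zpow_orbit_injective {C : Type} [PartialOrder C] {Φ : Equiv.Perm C}
    (hΦ : IsCausalAuto Φ) {k : ℤ} {x : C} (hx : x < (Φ ^ k) x) :
    Function.Injective fun n : ℤ => (Φ ^ n) x := by
  intro a b hab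
  have hs : (Φ ^ (a - b)) x = x := by
    rw [sub_eq_neg_add, zpow_add, Equiv.Perm.mul_apply]
    simp only at hab
    rw [hab, ← Equiv.Perm.mul_apply, ← zpow_add]
    simp
  have h2 : (Φ ^ (k * (a - b))) x = x := by
    rw [mul_comm, zpow_mul]
    exact Function.IsFixedPt.perm_zpow hs k
  have := (hΦ.strictMono_zpow_mul hx).injective (a₁ := a - b) (a₂ := 0) (by simpa using h2)
  omega

/-- The points lying below `x` but below no earlier point of the orbit of `x`. -/
def firstBelow {C : Type} [PartialOrder C] (Φ : Equiv.Perm C) (x : C) : Set C :=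
  {y | y ≤ x ∧ ∀ j : ℤ, j < 0 → ¬ y ≤ (Φ ^ j) x}

theorem exists_lt_zpow_of_mem_firstBelow {C : Type} [PartialOrder C] {Φ : Equiv.Perm C}
    (hΦ : IsCausalAuto Φ)
    (hac : ∀ x : C, ∀ A : Set C, IsAntichain (· ≤ ·) A → ({y : C | y ≤ x} ∩ A).Finite)
    {k : ℤ} {x y : C} (hk : 0 < k) (hx : x < (Φ ^ k) x) (hy : y ∈ firstBelow Φ x) :
    ∃ s : ℤ, 0 < s ∧ y < (Φ ^ s) y := by
  have hneg : ∀ s : ℤ, s < 0 → ¬ y ≤ (Φ ^ s) y := fun s hs h =>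
    hy.2 s hs (h.trans ((hΦ.zpow_le_iff _ _ _).2 hy.1))
  have hshift : ∀ a b : ℤ, (Φ ^ a) y ≤ (Φ ^ b) y → y ≤ (Φ ^ (b - a)) y := by
    intro a b h
    rw [← hΦ.zpow_le_iff a, ← Equiv.Perm.mul_apply, ← zpow_add]
    simpa using h
  have hinj : Function.Injective fun n : ℤ => (Φ ^ n) y := by
    intro a b hab
    by_contra hne
    rcases lt_or_gt_of_ne hne with h | h
    · exact hneg (a - b) (by omega) (hshift b a hab.ge)
    · exact hneg (b - a) (by omega) (hshift a b hab.le)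
  let f : ℕ → C := fun i => (Φ ^ (k * -(i : ℤ))) y
  have hf : Function.Injective f := by
    intro a b hab
    have h := hinj hab
    have := mul_left_cancel₀ hk.ne' h
    omega
  have hna : ¬ IsAntichain (· ≤ ·) (Set.range f) := by
    intro hA
    refine Set.infinite_range_of_injective hf ((hac x _ hA).subset ?_)
    rintro _ ⟨i, rfl⟩
    refine ⟨((hΦ.zpow_le_iff _ _ _).2 hy.1).trans ?_, ⟨i, rfl⟩⟩
    simpa using (hΦ.strictMono_zpow_mul hx).monotone (a := -(i : ℤ)) (b := 0) (by omega)
  simp only [IsAntichain, Set.Pairwise] at hna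
  push Not at hna
  obtain ⟨_, ⟨a, rfl⟩, _, ⟨b, rfl⟩, hne, hle⟩ := hna
  simp only [Pi.compl_apply, compl_iff_not, not_not] at hle
  have hle' := hshift _ _ hle
  have hs0 : k * -(b : ℤ) - k * -(a : ℤ) ≠ 0 := fun h0 => hne (by
    simp only [f]; rw [sub_eq_zero.1 h0])
  have hspos : 0 < k * -(b : ℤ) - k * -(a : ℤ) := by
    by_contra hcon
    exact hneg _ (by omega) hle'
  refine ⟨_, hspos, lt_of_le_of_ne hle' fun he => hs0 ?_⟩
  exact (hinj (a₁ := 0) (by simpa using he)).symm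

theorem finite_firstBelow {C : Type} [PartialOrder C] {Φ : Equiv.Perm C}
    (hΦ : IsCausalAuto Φ) (hwb : IsWellBehavedCausalSet C)
    {k : ℤ} {x : C} (hk : 0 < k) (hx : x < (Φ ^ k) x)
    (hup : ∀ i : ℤ, ∀ z, (Φ ^ i) x ≤ z → ∃ j, i ≤ j ∧ z = (Φ ^ j) x) :
    (firstBelow Φ x).Finite := by
  obtain ⟨-, hlf, hcov, hb, -⟩ := hwb
  have hac := fun x A hA => (hb x A hA).1
  by_contra hinf
  obtain ⟨d, hd, hdP⟩ := exists_strictAnti_of_infinite hlf hac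
    (P := firstBelow Φ x \ {x}) (x := x) (fun y hy => hy.1.1)
    (Set.Infinite.sdiff hinf (Set.finite_singleton x))
  obtain ⟨s, hs, hds⟩ := exists_lt_zpow_of_mem_firstBelow hΦ hac hk hx (hdP 0).1
  have hdO : ∀ j : ℤ, d 0 ≠ (Φ ^ j) x := by
    intro j hj
    rcases lt_or_ge j 0 with h | h
    · exact (hdP 0).1.2 j h hj.le
    · obtain ⟨l, hl, hxl⟩ := hup j x (hj ▸ (hdP 0).1.1)
      have h0 : (0 : ℤ) = l := zpow_orbit_injective hΦ hx (by simpa using hxl)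
      obtain rfl : j = 0 := by omega
      exact (hdP 0).2 (by simpa using hj)
  let u : ℕ → C := fun n => (Φ ^ (s * (n : ℤ))) (d 0)
  have hu : StrictMono u := fun a b hab =>
    hΦ.strictMono_zpow_mul hds (by exact_mod_cast hab)
  have hdu : ∀ m n, d m ≤ u n := by
    intro m n
    have h0 : u 0 = d 0 := by simp [u]
    exact (hd.antitone m.zero_le).trans (h0 ▸ hu.monotone n.zero_le)
  have hE : IsChain (· ≤ ·) (Set.range d ∪ Set.range u) := by
    rintro _ (⟨m, rfl⟩ | ⟨m, rfl⟩) _ (⟨n, rfl⟩ | ⟨n, rfl⟩) -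
    · exact (le_total m n).symm.imp (fun h => hd.antitone h) fun h => hd.antitone h
    · exact Or.inl (hdu m n)
    · exact Or.inr (hdu n m)
    · exact (le_total m n).imp (fun h => hu.monotone h) fun h => hu.monotone h
  obtain ⟨D, hD, hED⟩ := IsChain.exists_maxChain hE
  have hmem := hcov D hD {(Φ ^ (-1 : ℤ)) x} (IsAntichain.singleton) rfl
  simp only [Set.mem_iUnion] at hmem
  obtain ⟨c, hcD, hc | hc⟩ := hmem
  · obtain ⟨j, -, rfl⟩ := hup (-1) c hc
    obtain ⟨n, hn⟩ := exists_not_le_of_strictMono hlf hu ((Φ ^ j) x)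
    have hle : (Φ ^ j) x ≤ u n :=
      (hD.1.total (hED (Or.inr ⟨n, rfl⟩)) hcD).resolve_left hn
    obtain ⟨i, -, hi⟩ := hup j _ hle
    refine hdO (-(s * n) + i) ?_
    rw [zpow_add, Equiv.Perm.mul_apply, ← hi, ← Equiv.Perm.mul_apply, ← zpow_add]
    simp
  · obtain ⟨n, hn⟩ := exists_not_ge_of_strictAnti hlf hd c
    have hle : d n ≤ c := (hD.1.total (hED (Or.inl ⟨n, rfl⟩)) hcD).resolve_right hn
    exact (hdP n).1.2 (-1) (by norm_num) (hle.trans hc)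

theorem exists_zpow_mem_firstBelow {C : Type} [PartialOrder C] {Φ : Equiv.Perm C}
    (hΦ : IsCausalAuto Φ) (hwb : IsWellBehavedCausalSet C)
    {k : ℤ} {x : C} (hk : 0 < k) (hx : x < (Φ ^ k) x)
    (hup : ∀ i : ℤ, ∀ z, (Φ ^ i) x ≤ z → ∃ j, i ≤ j ∧ z = (Φ ^ j) x) (z : C) :
    ∃ i : ℤ, (Φ ^ i) z ∈ firstBelow Φ x := by
  obtain ⟨-, hlf, hcov, -, -⟩ := hwb
  have hmono := hΦ.strictMono_zpow_mul hx
  have hu : StrictMono fun n : ℕ => (Φ ^ (k * (n : ℤ))) x := fun a b hab =>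
    hmono (by exact_mod_cast hab)
  have hd : StrictAnti fun n : ℕ => (Φ ^ (k * (-n : ℤ))) x := fun a b hab =>
    hmono (by omega)
  have hbelow : ∃ j : ℤ, z ≤ (Φ ^ j) x := by
    have hE : IsChain (· ≤ ·) (Set.range fun n : ℤ => (Φ ^ (k * n)) x) := by
      rintro _ ⟨m, rfl⟩ _ ⟨n, rfl⟩ -
      exact (le_total m n).imp (fun h => hmono.monotone h) fun h => hmono.monotone h
    obtain ⟨D, hD, hED⟩ := IsChain.exists_maxChain hE
    have hmem := hcov D hD {z} (IsAntichain.singleton) rfl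
    simp only [Set.mem_iUnion] at hmem
    obtain ⟨c, hcD, hc | hc⟩ := hmem
    · obtain ⟨n, hn⟩ := exists_not_le_of_strictMono hlf hu c
      exact ⟨_, le_trans hc ((hD.1.total (hED ⟨n, rfl⟩) hcD).resolve_left hn)⟩
    · obtain ⟨n, hn⟩ := exists_not_ge_of_strictAnti hlf hd c
      have hle := (hD.1.total (hED ⟨-n, rfl⟩) hcD).resolve_right hn
      obtain ⟨j, -, hj⟩ := hup _ z (hle.trans hc)
      exact ⟨j, hj.le⟩
  have hfin : {j : ℤ | j < k ∧ z ≤ (Φ ^ j) x}.Finite := by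
    have hU : (⋃ r ∈ Set.Ico 0 k, Set.Icc z ((Φ ^ r) x)).Finite :=
      (Set.finite_Ico 0 k).biUnion fun r _ => hlf _ _
    refine Set.Finite.of_finite_image (hU.subset ?_)
      (zpow_orbit_injective hΦ hx).injOn
    rintro _ ⟨j, ⟨hjk, hj⟩, rfl⟩
    refine Set.mem_biUnion (x := j % k)
      ⟨Int.emod_nonneg _ hk.ne', Int.emod_lt_of_pos _ hk⟩ ⟨hj, ?_⟩
    have hq : j / k ≤ 0 := by
      have := Int.ediv_lt_of_lt_mul hk (a := j) (b := 1) (by simpa using hjk)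
      omega
    have h1 : (Φ ^ (k * (j / k))) x ≤ x := by simpa using hmono.monotone hq
    have h2 := (hΦ.zpow_le_iff (j % k) _ _).2 h1
    rwa [← Equiv.Perm.mul_apply, ← zpow_add, Int.emod_add_mul_ediv] at h2
  obtain ⟨b, hb⟩ := hfin.bddBelow
  obtain ⟨m, hm, hmin⟩ := Int.exists_least_of_bdd (P := fun j => z ≤ (Φ ^ j) x)
    ⟨min b k, fun j hj => by
      by_cases h : j < k
      · exact (min_le_left _ _).trans (hb ⟨h, hj⟩)
      · exact (min_le_right _ _).trans (not_lt.1 h)⟩ hbelow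
  refine ⟨-m, ?_, fun j hj hle => ?_⟩
  · rw [← hΦ.zpow_le_iff m, ← Equiv.Perm.mul_apply, ← zpow_add]
    simpa using hm
  · rw [← hΦ.zpow_le_iff m, ← Equiv.Perm.mul_apply, ← Equiv.Perm.mul_apply, ← zpow_add,
      ← zpow_add] at hle
    have := hmin (m + j) (by simpa using hle)
    omega

/-- A well behaved causal set is not exhausted, above a point `x` with `x < Φ ^ k x`, by the
orbit of `x`. -/
theorem exists_gt_forall_ne_zpow {C : Type} [PartialOrder C] {Φ : Equiv.Perm C}
    (hΦ : IsCausalAuto Φ) (hwb : IsWellBehavedCausalSet C)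
    {k : ℤ} {x : C} (hk : 0 < k) (hx : x < (Φ ^ k) x) :
    ∃ z, x < z ∧ ∀ l : ℤ, 0 < l → z ≠ (Φ ^ l) x := by
  by_contra! hS
  have hup : ∀ i : ℤ, ∀ z, (Φ ^ i) x ≤ z → ∃ j, i ≤ j ∧ z = (Φ ^ j) x := by
    intro i z hz
    rcases hz.eq_or_lt with h | h
    · exact ⟨i, le_rfl, h.symm⟩
    have hle : x ≤ (Φ ^ (-i)) z := by
      rw [← hΦ.zpow_le_iff i, ← Equiv.Perm.mul_apply, ← zpow_add]
      simpa using hz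
    have hne : x ≠ (Φ ^ (-i)) z := by
      intro he
      apply h.ne
      rw [he, ← Equiv.Perm.mul_apply, ← zpow_add]
      simp
    obtain ⟨l, hl, he⟩ := hS _ (lt_of_le_of_ne hle hne)
    refine ⟨i + l, by omega, ?_⟩
    rw [zpow_add, Equiv.Perm.mul_apply, ← he, ← Equiv.Perm.mul_apply, ← zpow_add]
    simp
  have hfin := finite_firstBelow hΦ hwb hk hx hup
  choose i hi using exists_zpow_mem_firstBelow hΦ hwb hk hx hup
  obtain ⟨-, -, -, hb, A, hA, hAinf⟩ := hwb
  have hs : ∀ y, ∃ s : ℤ, y ∈ firstBelow Φ x → 0 < s ∧ y < (Φ ^ s) y := by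
    intro y
    by_cases hy : y ∈ firstBelow Φ x
    · obtain ⟨s, h⟩ := exists_lt_zpow_of_mem_firstBelow hΦ (fun x A hA => (hb x A hA).1) hk hx hy
      exact ⟨s, fun _ => h⟩
    · exact ⟨0, fun h => absurd h hy⟩
  choose s hs using hs
  have hT : (⋃ y ∈ firstBelow Φ x, ({y} : Set C) ×ˢ Set.Ico 0 (s y)).Finite :=
    hfin.biUnion fun y _ => (Set.finite_singleton y).prod (Set.finite_Ico _ _)
  obtain ⟨a, ha, b, hbA, hab, heq⟩ := hAinf.exists_ne_map_eq_of_mapsTo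
    (f := fun a => ((Φ ^ i a) a, i a % s ((Φ ^ i a) a))) (fun a _ => by
      simp only [Set.mem_iUnion]
      exact ⟨_, hi a, rfl, Int.emod_nonneg _ (hs _ (hi a)).1.ne',
        Int.emod_lt_of_pos _ (hs _ (hi a)).1⟩) hT
  obtain ⟨h1, h2⟩ := Prod.mk.inj heq
  obtain ⟨-, hlt⟩ := hs _ (hi a)
  rw [← h1] at h2
  generalize hya : (Φ ^ i a) a = y at h1 h2 hlt
  have hinv : ∀ c, (Φ ^ i c) c = y → c = (Φ ^ (-i c)) y := by
    rintro c rfl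
    rw [← Equiv.Perm.mul_apply, ← zpow_add]
    simp
  obtain ⟨t, ht⟩ := Int.ModEq.dvd h2
  have hba : a = (Φ ^ (-i b)) ((Φ ^ (s y * t)) y) := by
    rw [← Equiv.Perm.mul_apply, ← zpow_add, ← ht, show -i b + (i b - i a) = -i a by ring]
    exact hinv a hya
  have hmono := (hΦ.strictMono_zpow_mul hlt).monotone
  have hle : ∀ u v, u ≤ v → (Φ ^ (-i b)) ((Φ ^ (s y * u)) y) ≤ (Φ ^ (-i b)) ((Φ ^ (s y * v)) y) :=
    fun u v h => (hΦ.zpow_le_iff _ _ _).2 (hmono h)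
  have hbb : b = (Φ ^ (-i b)) ((Φ ^ (s y * 0)) y) := by simpa using hinv b h1.symm
  rcases le_total t 0 with h | h
  · exact hA ha hbA hab (hba.trans_le ((hle _ _ h).trans_eq hbb.symm))
  · exact hA hbA ha hab.symm (hbb.trans_le ((hle _ _ h).trans_eq hba.symm))

/-- Under the hypotheses of case (b): every point incomparable with its image under
`Φ` and `x₀ < Φ^k₀ x₀` for some `k₀ ≥ 2`, the set `Σ` of minimal elements of
`{x | x₀ < x ∧ x ≠ Φ^ℓ x₀ for all ℓ > 0}` is nonempty. -/
theorem minimals_nonempty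
    {C : Type} [PartialOrder C] (hwb : IsWellBehavedCausalSet C)
    (Φ : Equiv.Perm C) (hΦ : IsCausalAuto Φ)
    (hunrel : ∀ x : C, ¬ x ≤ Φ x ∧ ¬ Φ x ≤ x)
    (x₀ : C) (k₀ : ℤ) (hk₀ : 2 ≤ k₀) (hx₀ : x₀ < (Φ ^ k₀) x₀) :
    ({b ∈ {x : C | x₀ < x ∧ ∀ ℓ : ℤ, 0 < ℓ → x ≠ (Φ ^ ℓ) x₀} |
        ∀ x ∈ {x : C | x₀ < x ∧ ∀ ℓ : ℤ, 0 < ℓ → x ≠ (Φ ^ ℓ) x₀}, ¬ x < b} :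
      Set C).Nonempty := by
  obtain ⟨z, hz⟩ := exists_gt_forall_ne_zpow hΦ hwb (by omega) hx₀
  have hfin := (hwb.2.1 x₀ z).inter_of_left
    {x : C | x₀ < x ∧ ∀ ℓ : ℤ, 0 < ℓ → x ≠ (Φ ^ ℓ) x₀}
  obtain ⟨b, hb⟩ := hfin.exists_minimal ⟨z, ⟨hz.1.le, le_rfl⟩, hz⟩
  exact ⟨b, hb.prop.2, fun x hx hxb =>
    hb.not_lt ⟨⟨hx.1.le, hxb.le.trans hb.prop.1.2⟩, hx⟩ hxb⟩
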